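/- Let d ≥ 2 and let G be a countable weakly branch group of automorphisms of the rooted d-ary tree T_d. Then G admits a continuous ergodic IRS: there exists an atomless, conjugation-invariant, ergodic Borel probability measure on the space S(G) of subgroups of G, namely the pushforward of the uniform Bernoulli measure on the boundary ∂T_d under the stabilizer map ξ ↦ St_G(ξ). -/

import Mathlib

open MeasureTheory
open scoped ENNReal

/- The characteristic function of a subgroup, as an element of `{0,1}^G`. -/
open Classical in
noncomputable def subgroupChar {G : Type*} [Group G] (N : Subgroup G) : G → Bool :=
  fun g => decide (g ∈ N)

/-- The topology on the space `S(G)` of subgroups of `G`, induced from the product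
(Tychonoff) topology on `{0,1}^G` via characteristic functions. -/
noncomputable instance {G : Type*} [Group G] : TopologicalSpace (Subgroup G) :=
  TopologicalSpace.induced subgroupChar inferInstance

/-- The Borel σ-algebra on the space of subgroups. -/
noncomputable instance {G : Type*} [Group G] : MeasurableSpace (Subgroup G) :=
  borel (Subgroup G)

/-- The conjugate subgroup `N^x = x⁻¹ N x`. -/
def conjSubgroup {G : Type*} [Group G] (x : G) (N : Subgroup G) : Subgroup G :=
  N.map (MulAut.conj x⁻¹).toMonoidHom

/-- A tree automorphism of the rooted `d`-ary tree (vertices = finite words over `Fin d`):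
a permutation of the vertex set preserving word length and the prefix relation in both
directions. -/
def IsTreeAut {d : ℕ} (f : Equiv.Perm (List (Fin d))) : Prop :=
  (∀ u : List (Fin d), (f u).length = u.length) ∧
    ∀ u v : List (Fin d), u <+: v ↔ f u <+: f v

/-- The length-`n` prefix of a boundary ray `ξ ∈ {0,…,d-1}^ℕ`. -/
def rayPrefix {d : ℕ} (ξ : ℕ → Fin d) (n : ℕ) : List (Fin d) :=
  List.ofFn fun i : Fin n => ξ i

/-- The stabilizer in `G` (acting on the tree via `ρ`) of the boundary ray `ξ`:
elements fixing every finite prefix of `ξ`. -/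
def rayStabilizer {d : ℕ} {G : Type*} [Group G] (ρ : G →* Equiv.Perm (List (Fin d)))
    (ξ : ℕ → Fin d) : Subgroup G where
  carrier := {g : G | ∀ n : ℕ, ρ g (rayPrefix ξ n) = rayPrefix ξ n}
  one_mem' := by intro n; simp
  mul_mem' := by
    intro a b ha hb n
    simp only [map_mul, Equiv.Perm.mul_apply, hb n, ha n]
  inv_mem' := by
    intro a ha n
    rw [map_inv]
    exact (Equiv.Perm.inv_eq_iff_eq (f := ρ a)).mpr ((ha n).symm) |>.symm ▸ rfl

theorem length_rayPrefix {d : ℕ} (ξ : ℕ → Fin d) (n : ℕ) : (rayPrefix ξ n).length = n := by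
  simp [rayPrefix]

theorem getElem_rayPrefix {d : ℕ} (ξ : ℕ → Fin d) (n i : ℕ) (h : i < (rayPrefix ξ n).length) :
    (rayPrefix ξ n)[i] = ξ i := by
  simp [rayPrefix]

theorem rayPrefix_prefix {d : ℕ} (ξ : ℕ → Fin d) {m n : ℕ} (h : m ≤ n) :
    rayPrefix ξ m <+: rayPrefix ξ n := by
  have : rayPrefix ξ m = (rayPrefix ξ n).take m := by
    apply List.ext_getElem
    · simp [length_rayPrefix, h]
    · intro i h₁ h₂
      rw [List.getElem_take, getElem_rayPrefix, getElem_rayPrefix]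
  rw [this]
  exact List.take_prefix _ _

theorem prefix_rayPrefix_iff {d : ℕ} (ξ : ℕ → Fin d) (u : List (Fin d)) {n : ℕ}
    (h : u.length ≤ n) : u <+: rayPrefix ξ n ↔ rayPrefix ξ u.length = u := by
  constructor
  · intro hu
    exact (List.prefix_of_prefix_length_le (rayPrefix_prefix ξ h) hu
      (length_rayPrefix ξ _).le).eq_of_length (length_rayPrefix ξ _)
  · intro hu
    have := rayPrefix_prefix ξ h
    rwa [hu] at this

theorem ray_ext {d : ℕ} {ξ η : ℕ → Fin d} (h : ∀ n, rayPrefix ξ n = rayPrefix η n) : ξ = η := by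
  funext n
  rw [← getElem_rayPrefix ξ (n + 1) n (by simp [length_rayPrefix]),
    ← getElem_rayPrefix η (n + 1) n (by simp [length_rayPrefix])]
  simp only [h]

/-- The set of rays passing through the vertex `u`. -/
def rayCylinder {d : ℕ} (u : List (Fin d)) : Set (ℕ → Fin d) :=
  {ξ | rayPrefix ξ u.length = u}

theorem rayCylinder_eq_pi {d : ℕ} (u : List (Fin d)) :
    rayCylinder u = Set.pi (Finset.range u.length) fun i => {a | u[i]? = some a} := by
  ext ξ
  simp only [rayCylinder, Set.mem_ofPred_eq, Set.mem_pi, Finset.coe_range, Set.mem_Iio]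
  constructor
  · intro h i hi
    rw [← h, List.getElem?_eq_getElem (by simpa [length_rayPrefix] using hi), getElem_rayPrefix]
  · intro h
    apply List.ext_getElem (length_rayPrefix ξ _)
    intro i h₁ h₂
    have := h i h₂
    rw [List.getElem?_eq_getElem h₂] at this
    rw [getElem_rayPrefix]
    exact (Option.some.inj this).symm

theorem measurableSet_rayCylinder {d : ℕ} (u : List (Fin d)) : MeasurableSet (rayCylinder u) := by
  rw [rayCylinder_eq_pi]
  exact MeasurableSet.pi (Set.to_countable _) fun _ _ => MeasurableSet.of_discrete

theorem generateFrom_range_rayCylinder {d : ℕ} :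
    (MeasurableSpace.pi : MeasurableSpace (ℕ → Fin d)) =
      MeasurableSpace.generateFrom (Set.range rayCylinder) := by
  apply le_antisymm
  · refine iSup_le fun n => ?_
    rw [← measurable_iff_comap_le]
    refine @measurable_to_countable' _ _ _ _ (_) _ fun a => ?_
    have : (fun ξ : ℕ → Fin d => ξ n) ⁻¹' {a} =
        ⋃ u ∈ {u : List (Fin d) | u.length = n + 1 ∧ u[n]? = some a}, rayCylinder u := by
      ext ξ
      simp only [Set.mem_preimage, Set.mem_singleton_iff, Set.mem_iUnion, Set.mem_ofPred_eq,
        exists_prop, rayCylinder]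
      have hn : (rayPrefix ξ (n + 1))[n]? = some (ξ n) := by
        rw [List.getElem?_eq_getElem (by simp [length_rayPrefix]), getElem_rayPrefix]
      constructor
      · rintro rfl
        exact ⟨rayPrefix ξ (n + 1), ⟨length_rayPrefix _ _, hn⟩, by rw [length_rayPrefix]⟩
      · rintro ⟨u, ⟨hu, hua⟩, h⟩
        rw [hu] at h
        rw [← h, hn] at hua
        exact Option.some.inj hua
    rw [this]
    refine @MeasurableSet.biUnion _ _ (_) _ _ (Set.to_countable _) fun u _ => ?_
    exact MeasurableSpace.measurableSet_generateFrom ⟨u, rfl⟩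
  · refine MeasurableSpace.generateFrom_le ?_
    rintro _ ⟨u, rfl⟩
    exact measurableSet_rayCylinder u

theorem rayCylinder_inter {d : ℕ} {u v : List (Fin d)} (h : u.length ≤ v.length)
    (hne : (rayCylinder u ∩ rayCylinder v).Nonempty) :
    rayCylinder u ∩ rayCylinder v = rayCylinder v := by
  obtain ⟨ξ, hu, hv⟩ := hne
  have huv : u <+: v := by
    have := (prefix_rayPrefix_iff ξ u h).2 hu
    rwa [show rayPrefix ξ v.length = v from hv] at this
  refine Set.inter_eq_right.2 fun η hη => ?_
  rw [← show rayPrefix η v.length = v from hη] at huv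
  exact (prefix_rayPrefix_iff η u h).1 huv

theorem isPiSystem_range_rayCylinder {d : ℕ} :
    IsPiSystem (Set.range (rayCylinder (d := d))) := by
  rintro _ ⟨u, rfl⟩ _ ⟨v, rfl⟩ hne
  rcases le_total u.length v.length with h | h
  · exact ⟨v, (rayCylinder_inter h hne).symm⟩
  · rw [Set.inter_comm] at hne ⊢
    exact ⟨u, (rayCylinder_inter h hne).symm⟩

theorem rayCylinder_nil {d : ℕ} : rayCylinder ([] : List (Fin d)) = Set.univ := by
  ext ξ
  simp [rayCylinder, rayPrefix]

theorem measure_ext_rayCylinder {d : ℕ} {μ ν : Measure (ℕ → Fin d)} [IsFiniteMeasure μ]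
    (h : ∀ u, μ (rayCylinder u) = ν (rayCylinder u)) : μ = ν := by
  refine ext_of_generate_finite _ generateFrom_range_rayCylinder isPiSystem_range_rayCylinder ?_ ?_
  · rintro _ ⟨u, rfl⟩
    exact h u
  · simpa [rayCylinder_nil] using h []

/-- The uniform Bernoulli measure on the boundary of the `d`-ary tree. -/
noncomputable def bernoulliRay (d : ℕ) [NeZero d] : Measure (ℕ → Fin d) :=
  Measure.infinitePi fun _ => (PMF.uniformOfFintype (Fin d)).toMeasure

instance {d : ℕ} [NeZero d] : IsProbabilityMeasure (bernoulliRay d) := by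
  unfold bernoulliRay
  infer_instance

theorem bernoulliRay_rayCylinder {d : ℕ} [NeZero d] (u : List (Fin d)) :
    bernoulliRay d (rayCylinder u) = (d : ℝ≥0∞)⁻¹ ^ u.length := by
  rw [rayCylinder_eq_pi, bernoulliRay, Measure.infinitePi_pi _ fun _ _ => MeasurableSet.of_discrete]
  rw [Finset.prod_congr rfl (g := fun _ => (d : ℝ≥0∞)⁻¹)]
  · simp
  · intro i hi
    have hi' : i < u.length := Finset.mem_range.1 hi
    have : {a | u[i]? = some a} = {u[i]} := by
      ext a
      simp [List.getElem?_eq_getElem hi', eq_comm]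
    rw [this, PMF.toMeasure_apply_singleton _ _ MeasurableSet.of_discrete]
    simp

theorem bernoulliRay_singleton {d : ℕ} [NeZero d] (hd : 2 ≤ d) (ξ : ℕ → Fin d) :
    bernoulliRay d {ξ} = 0 := by
  have hlt : (d : ℝ≥0∞)⁻¹ < 1 := by
    rw [ENNReal.inv_lt_one]
    exact_mod_cast hd
  refine le_antisymm (ge_of_tendsto' (ENNReal.tendsto_pow_atTop_nhds_zero_of_lt_one hlt)
    fun n => ?_) zero_le
  have h := bernoulliRay_rayCylinder (rayPrefix ξ n)
  rw [length_rayPrefix] at h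
  rw [← h]
  refine measure_mono ?_
  rintro _ rfl
  simp [rayCylinder, length_rayPrefix]

/-- The action of a tree automorphism on the boundary. -/
def rayAct {d : ℕ} {f : Equiv.Perm (List (Fin d))} (hf : IsTreeAut f) (ξ : ℕ → Fin d) :
    ℕ → Fin d :=
  fun n => (f (rayPrefix ξ (n + 1)))[n]'(by simp [hf.1, length_rayPrefix])

theorem rayPrefix_rayAct {d : ℕ} {f : Equiv.Perm (List (Fin d))} (hf : IsTreeAut f)
    (ξ : ℕ → Fin d) (n : ℕ) : rayPrefix (rayAct hf ξ) n = f (rayPrefix ξ n) := by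
  apply List.ext_getElem
  · simp [hf.1, length_rayPrefix]
  · intro i h₁ h₂
    rw [getElem_rayPrefix]
    rw [length_rayPrefix] at h₁
    exact ((hf.2 _ _).1 (rayPrefix_prefix ξ h₁)).getElem _

theorem rayAct_preimage_rayCylinder {d : ℕ} {f : Equiv.Perm (List (Fin d))} (hf : IsTreeAut f)
    (u : List (Fin d)) : rayAct hf ⁻¹' rayCylinder (f u) = rayCylinder u := by
  ext ξ
  simp [rayCylinder, rayPrefix_rayAct, hf.1]

theorem measurable_rayAct {d : ℕ} {f : Equiv.Perm (List (Fin d))} (hf : IsTreeAut f) :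
    Measurable (rayAct hf) := by
  have : ∀ s ∈ Set.range (rayCylinder (d := d)), MeasurableSet (rayAct hf ⁻¹' s) := by
    rintro _ ⟨u, rfl⟩
    obtain ⟨v, rfl⟩ := f.surjective u
    rw [rayAct_preimage_rayCylinder]
    exact measurableSet_rayCylinder v
  have h := @measurable_generateFrom _ _ MeasurableSpace.pi _ _ this
  rwa [← generateFrom_range_rayCylinder] at h

theorem measurePreserving_rayAct {d : ℕ} [NeZero d] {f : Equiv.Perm (List (Fin d))}
    (hf : IsTreeAut f) : MeasurePreserving (rayAct hf) (bernoulliRay d) (bernoulliRay d) := by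
  refine ⟨measurable_rayAct hf, (measure_ext_rayCylinder fun u => ?_).symm⟩
  obtain ⟨v, rfl⟩ := f.surjective u
  rw [Measure.map_apply (measurable_rayAct hf) (measurableSet_rayCylinder _),
    rayAct_preimage_rayCylinder, bernoulliRay_rayCylinder, bernoulliRay_rayCylinder, hf.1]

theorem measure_eq_sum_rayCylinder {d : ℕ} (μ : Measure (ℕ → Fin d)) (A : Set (ℕ → Fin d))
    (hA : MeasurableSet A) (n : ℕ) :
    μ A = ∑ w : Fin n → Fin d, μ (A ∩ rayCylinder (List.ofFn w)) := by
  have hmem : ∀ (w : Fin n → Fin d) (ξ : ℕ → Fin d), ξ ∈ rayCylinder (List.ofFn w) ↔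
      (fun i : Fin n => ξ i) = w := by
    intro w ξ
    simp only [rayCylinder, Set.mem_ofPred_eq, List.length_ofFn]
    exact List.ofFn_injective.eq_iff
  have hU : A = ⋃ w : Fin n → Fin d, A ∩ rayCylinder (List.ofFn w) := by
    ext ξ
    simp [hmem]
  conv_lhs => rw [hU]
  rw [measure_iUnion, tsum_fintype]
  · intro w w' hww
    refine Set.disjoint_left.2 fun ξ h h' => hww ?_
    rw [← (hmem w ξ).1 h.2, ← (hmem w' ξ).1 h'.2]
  · exact fun w => hA.inter (measurableSet_rayCylinder _)

/-- A level transitive family of tree automorphisms acts ergodically on the boundary. -/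
theorem bernoulliRay_eq_zero_or_one {d : ℕ} [NeZero d] {ι : Type*}
    {f : ι → Equiv.Perm (List (Fin d))} (hf : ∀ i, IsTreeAut (f i))
    (htrans : ∀ u v : List (Fin d), u.length = v.length → ∃ i, f i u = v)
    {A : Set (ℕ → Fin d)} (hA : MeasurableSet A) (hinv : ∀ i, rayAct (hf i) ⁻¹' A = A) :
    bernoulliRay d A = 0 ∨ bernoulliRay d A = 1 := by
  have heq : ∀ u v : List (Fin d), u.length = v.length →
      bernoulliRay d (A ∩ rayCylinder u) = bernoulliRay d (A ∩ rayCylinder v) := by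
    intro u v huv
    obtain ⟨i, rfl⟩ := htrans u v huv
    rw [← (measurePreserving_rayAct (hf i)).measure_preimage (s := A ∩ rayCylinder (f i u))
      (hA.inter (measurableSet_rayCylinder _)).nullMeasurableSet, Set.preimage_inter, hinv,
      rayAct_preimage_rayCylinder]
  have hcyl : ∀ u : List (Fin d), bernoulliRay d (A ∩ rayCylinder u) =
      bernoulliRay d A * bernoulliRay d (rayCylinder u) := by
    intro u
    rw [measure_eq_sum_rayCylinder _ A hA u.length,
      Finset.sum_congr rfl fun w _ => heq (List.ofFn w) u (by simp), bernoulliRay_rayCylinder]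
    have h0 : (d : ℝ≥0∞) ^ u.length ≠ 0 := pow_ne_zero _ (by simp [NeZero.ne d])
    have ht : (d : ℝ≥0∞) ^ u.length ≠ ⊤ := ENNReal.pow_ne_top (by simp)
    simp only [Finset.sum_const, Finset.card_univ, Fintype.card_fun, Fintype.card_fin,
      nsmul_eq_mul, Nat.cast_pow]
    rw [mul_comm, ← mul_assoc, ← ENNReal.inv_pow, ENNReal.inv_mul_cancel h0 ht, one_mul]
  have hrestrict : (bernoulliRay d).restrict A = bernoulliRay d A • bernoulliRay d := by
    refine measure_ext_rayCylinder fun u => ?_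
    rw [Measure.restrict_apply (measurableSet_rayCylinder u), Set.inter_comm, hcyl]
    simp
  have hsq : bernoulliRay d A = bernoulliRay d A * bernoulliRay d A := by
    have := congrArg (fun m => m A) hrestrict
    simpa using this
  by_cases h : bernoulliRay d A = 0
  · exact Or.inl h
  · refine Or.inr ?_
    have h' := (ENNReal.mul_right_inj h (measure_ne_top _ A)).1 ((mul_one _).trans hsq)
    exact h'.symm

theorem measurable_subgroup_iff {α G : Type*} [MeasurableSpace α] [Group G] [Countable G]
    {F : α → Subgroup G} : Measurable F ↔ ∀ g : G, MeasurableSet {a | g ∈ F a} := by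
  have hb : (borel (Subgroup G)) =
      MeasurableSpace.comap subgroupChar (MeasurableSpace.pi : MeasurableSpace (G → Bool)) := by
    rw [BorelSpace.measurable_eq (α := G → Bool), borel_comap]
  have : Measurable F ↔ Measurable (subgroupChar ∘ F) := by
    change @Measurable _ _ _ (borel (Subgroup G)) F ↔ _
    rw [hb]
    exact measurable_comap_iff
  rw [this, measurable_pi_iff]
  refine forall_congr' fun g => ?_
  constructor
  · intro h
    have := h (MeasurableSet.singleton true)
    convert this using 1
    ext a
    simp [subgroupChar]
  · intro h
    refine measurable_to_bool ?_
    convert h using 1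
    ext a
    simp [subgroupChar]

theorem measurableSet_mem_subgroup {G : Type*} [Group G] [Countable G] (g : G) :
    MeasurableSet {N : Subgroup G | g ∈ N} :=
  measurable_subgroup_iff.1 (measurable_id (α := Subgroup G)) g

theorem measurableSet_singleton_subgroup {G : Type*} [Group G] [Countable G] (N : Subgroup G) :
    MeasurableSet ({N} : Set (Subgroup G)) := by
  have : ({N} : Set (Subgroup G)) = ⋂ g : G, {M | g ∈ M ↔ g ∈ N} := by
    ext M
    simp [SetLike.ext_iff]
  rw [this]
  refine MeasurableSet.iInter fun g => ?_
  exact (measurableSet_mem_subgroup g).iff (MeasurableSet.const _)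

theorem mem_conjSubgroup {G : Type*} [Group G] {x h : G} {N : Subgroup G} :
    h ∈ conjSubgroup x N ↔ x * h * x⁻¹ ∈ N := by
  simp only [conjSubgroup, Subgroup.mem_map]
  constructor
  · rintro ⟨k, hk, rfl⟩
    simpa [mul_assoc] using hk
  · intro hk
    exact ⟨_, hk, by simp [mul_assoc]⟩

theorem measurable_conjSubgroup {G : Type*} [Group G] [Countable G] (x : G) :
    Measurable fun N : Subgroup G => conjSubgroup x N := by
  rw [measurable_subgroup_iff]
  intro g
  simp only [mem_conjSubgroup]
  exact measurableSet_mem_subgroup _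

section RayStabilizer

variable {d : ℕ} {G : Type*} [Group G] {ρ : G →* Equiv.Perm (List (Fin d))}

theorem mem_rayStabilizer {ξ : ℕ → Fin d} {g : G} :
    g ∈ rayStabilizer ρ ξ ↔ ∀ n, ρ g (rayPrefix ξ n) = rayPrefix ξ n :=
  Iff.rfl

theorem measurable_rayStabilizer [Countable G] : Measurable (rayStabilizer ρ) := by
  rw [measurable_subgroup_iff]
  intro g
  simp only [mem_rayStabilizer, Set.ofPred_forall]
  refine MeasurableSet.iInter fun n => ?_
  have : {ξ : ℕ → Fin d | ρ g (rayPrefix ξ n) = rayPrefix ξ n} =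
      ⋃ u ∈ {u : List (Fin d) | u.length = n ∧ ρ g u = u}, rayCylinder u := by
    ext ξ
    simp only [Set.mem_iUnion, Set.mem_ofPred_eq, exists_prop, rayCylinder]
    constructor
    · intro h
      exact ⟨rayPrefix ξ n, ⟨length_rayPrefix _ _, h⟩, by rw [length_rayPrefix]⟩
    · rintro ⟨u, ⟨rfl, hu⟩, h⟩
      rwa [h]
  rw [this]
  exact MeasurableSet.biUnion (Set.to_countable _) fun u _ => measurableSet_rayCylinder u

theorem conjSubgroup_rayStabilizer (htree : ∀ g : G, IsTreeAut (ρ g)) (g : G) (ξ : ℕ → Fin d) :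
    conjSubgroup g (rayStabilizer ρ ξ) = rayStabilizer ρ (rayAct (htree g⁻¹) ξ) := by
  ext h
  rw [mem_conjSubgroup, mem_rayStabilizer, mem_rayStabilizer]
  refine forall_congr' fun n => ?_
  rw [rayPrefix_rayAct]
  simp only [map_mul, Equiv.Perm.mul_apply, map_inv]
  rw [Equiv.Perm.eq_inv_iff_eq]

/-- In a weakly branch group, distinct rays have distinct stabilizers. -/
theorem rayStabilizer_injective (hfaithful : Function.Injective ρ)
    (htree : ∀ g : G, IsTreeAut (ρ g))
    (htrans : ∀ u v : List (Fin d), u.length = v.length → ∃ g : G, ρ g u = v)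
    (hrist : ∀ u : List (Fin d),
      ∃ g : G, g ≠ 1 ∧ ∀ v : List (Fin d), ¬ u <+: v → ρ g v = v) :
    Function.Injective (rayStabilizer ρ) := by
  intro ξ η hst
  by_contra hne
  obtain ⟨n, hn⟩ : ∃ n, rayPrefix ξ n ≠ rayPrefix η n := by
    by_contra! h
    exact hne (ray_ext h)
  obtain ⟨g, hg1, hg⟩ := hrist (rayPrefix ξ n)
  obtain ⟨v, hv⟩ : ∃ v, ρ g v ≠ v := by
    by_contra! h
    exact hg1 (hfaithful (by ext1 v; simp [h v]))
  have hpre : rayPrefix ξ n <+: v := by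
    by_contra h
    exact hv (hg v h)
  have hlen : n ≤ v.length := by simpa [length_rayPrefix] using hpre.length_le
  obtain ⟨h, hh⟩ := htrans (rayPrefix ξ v.length) v (length_rayPrefix _ _)
  have hhu : ρ h (rayPrefix ξ n) = rayPrefix ξ n := by
    have h₁ := ((htree h).2 _ _).1 (rayPrefix_prefix ξ hlen)
    rw [hh] at h₁
    exact (List.prefix_of_prefix_length_le h₁ hpre ((htree h).1 _).le).eq_of_length ((htree h).1 _)
  have hη : h⁻¹ * g * h ∈ rayStabilizer ρ η := by
    intro m
    simp only [map_mul, Equiv.Perm.mul_apply, map_inv]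
    rw [hg, Equiv.Perm.inv_eq_iff_eq]
    intro hm
    rw [← hhu, ← (htree h).2] at hm
    have hnm : n ≤ m := by simpa [length_rayPrefix] using hm.length_le
    have := (prefix_rayPrefix_iff η _ (by rwa [length_rayPrefix])).1 hm
    rw [length_rayPrefix] at this
    exact hn this.symm
  rw [← hst] at hη
  have := hη v.length
  simp only [map_mul, Equiv.Perm.mul_apply, map_inv, hh] at this
  rw [Equiv.Perm.inv_eq_iff_eq, hh] at this
  exact hv this

end RayStabilizer

/-- Let `d ≥ 2` and let `G` be a countable weakly branch group of
automorphisms of the rooted `d`-ary tree (faithful, level transitive, nontrivial rigid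
stabilizers).  Then `G` admits a continuous ergodic IRS: an atomless, conjugation-invariant,
ergodic Borel probability measure on `S(G)`, namely the pushforward of the uniform
Bernoulli measure on the boundary under the stabilizer map `ξ ↦ St_G(ξ)`. -/
theorem stmt_15 {d : ℕ} (hd : 2 ≤ d) {G : Type*} [Group G] [Countable G]
    (ρ : G →* Equiv.Perm (List (Fin d))) (hfaithful : Function.Injective ρ)
    (htree : ∀ g : G, IsTreeAut (ρ g))
    (htrans : ∀ u v : List (Fin d), u.length = v.length → ∃ g : G, ρ g u = v)
    (hrist : ∀ u : List (Fin d),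
      ∃ g : G, g ≠ 1 ∧ ∀ v : List (Fin d), ¬ u <+: v → ρ g v = v) :
    ∃ ν : Measure (Subgroup G), IsProbabilityMeasure ν ∧
      (∀ N : Subgroup G, ν {N} = 0) ∧
      (∀ g : G, ν.map (fun N => conjSubgroup g N) = ν) ∧
      (∀ s : Set (Subgroup G), MeasurableSet s →
        (∀ g : G, (fun N => conjSubgroup g N) ⁻¹' s = s) → ν s = 0 ∨ ν s = 1) ∧
      ∃ μ : Measure (ℕ → Fin d), IsProbabilityMeasure μ ∧
        (∀ u : List (Fin d),
          μ {ξ : ℕ → Fin d | rayPrefix ξ u.length = u} = ((d : ℝ≥0∞))⁻¹ ^ u.length) ∧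
        ν = μ.map (fun ξ : ℕ → Fin d => rayStabilizer ρ ξ) := by
  have : NeZero d := ⟨by omega⟩
  have hSt : Measurable (rayStabilizer ρ) := measurable_rayStabilizer
  refine ⟨(bernoulliRay d).map (rayStabilizer ρ), Measure.isProbabilityMeasure_map hSt.aemeasurable,
    fun N => ?_, fun g => ?_, fun s hs hinv => ?_, bernoulliRay d, inferInstance,
    bernoulliRay_rayCylinder, rfl⟩
  · rw [Measure.map_apply hSt (measurableSet_singleton_subgroup N)]
    have hsub : (rayStabilizer ρ ⁻¹' {N}).Subsingleton :=
      Set.subsingleton_singleton.preimage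
        (rayStabilizer_injective hfaithful htree htrans hrist)
    rcases hsub.eq_empty_or_singleton with h | ⟨ξ, h⟩
    · simp [h]
    · rw [h, bernoulliRay_singleton hd]
  · have hcomp : (fun N => conjSubgroup g N) ∘ rayStabilizer ρ =
        rayStabilizer ρ ∘ rayAct (htree g⁻¹) :=
      funext fun ξ => conjSubgroup_rayStabilizer htree g ξ
    rw [Measure.map_map (measurable_conjSubgroup g) hSt, hcomp,
      ← Measure.map_map hSt (measurable_rayAct _), (measurePreserving_rayAct _).map_eq]
  · rw [Measure.map_apply hSt hs]
    refine bernoulliRay_eq_zero_or_one htree htrans (hSt hs) fun g => ?_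
    obtain ⟨g, rfl⟩ := inv_surjective g
    ext ξ
    rw [Set.mem_preimage, Set.mem_preimage, ← conjSubgroup_rayStabilizer]
    exact Set.ext_iff.1 (hinv g) (rayStabilizer ρ ξ)
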